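/- arXiv:1607.03344 — 2 statements merged into one kernel-verified Lean document; each statement's English description precedes it below -/
import Mathlib

section
/- Let λ > 0, b > 0 and η > 0 be real numbers. Let X be a real random variable with probability density f(x) = 2πλ x e^{-πλ x²} on (0,∞), and let h be an exponential random variable with rate 1, independent of X. Then the ergodic capacity E[log₂(1 + (1/b)·h·X^{-η})] equals (2πλ/ln 2) · ∫₀^∞ e^{b x^η} Γ(0, b x^η) · x e^{-πλ x²} dx, where Γ(0,z) = ∫_z^∞ t^{-1} e^{-t} dt is the upper incomplete gamma function. -/
open MeasureTheory ProbabilityTheory Real Set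

lemma aux_int1 (c : ℝ) (hc : 0 < c) :
    IntegrableOn (fun y : ℝ => Real.exp (-y) * Real.log (1 + y / c)) (Ioi 0) := by
  have h1 : IntegrableOn (fun y : ℝ => c⁻¹ * (Real.exp (-y) * y ^ ((2:ℝ) - 1))) (Ioi 0) :=
    (Real.GammaIntegral_convergent (by norm_num : (0:ℝ) < 2)).const_mul _
  refine Integrable.mono' h1 (by fun_prop) ?_
  filter_upwards [ae_restrict_mem measurableSet_Ioi] with y hy
  have hy0 : (0:ℝ) < y := hy
  have hyc : 0 < y / c := by positivity
  have hl : 0 ≤ Real.log (1 + y / c) := Real.log_nonneg (by linarith)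
  have hl2 : Real.log (1 + y / c) ≤ y / c := by
    have := Real.log_le_sub_one_of_pos (by linarith : 0 < 1 + y / c)
    linarith
  rw [Real.norm_of_nonneg (by positivity)]
  have : ((2:ℝ) - 1) = 1 := by norm_num
  rw [this, Real.rpow_one]
  calc _ ≤ Real.exp (-y) * (y / c) := by gcongr
    _ = _ := by field_simp

lemma aux_int2 (c : ℝ) (hc : 0 < c) :
    IntegrableOn (fun y : ℝ => Real.exp (-y) * (c + y)⁻¹) (Ioi 0) := by
  have h1 : IntegrableOn (fun y : ℝ => c⁻¹ * Real.exp (-y)) (Ioi 0) :=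
    (integrableOn_exp_neg_Ioi 0).const_mul _
  refine Integrable.mono' h1 (by fun_prop) ?_
  filter_upwards [ae_restrict_mem measurableSet_Ioi] with y hy
  have hy0 : (0:ℝ) < y := hy
  rw [Real.norm_of_nonneg (by positivity), mul_comm]
  gcongr
  linarith

lemma aux_key (c : ℝ) (hc : 0 < c) :
    ∫ y in Ioi (0:ℝ), Real.exp (-y) * Real.log (1 + y / c) =
      Real.exp c * ∫ t in Ioi c, t⁻¹ * Real.exp (-t) := by
  have hd : ∀ y ∈ Ici (0:ℝ), HasDerivAt (fun y => -(Real.exp (-y) * Real.log (1 + y / c)))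
      (Real.exp (-y) * Real.log (1 + y / c) - Real.exp (-y) * (c + y)⁻¹) y := by
    intro y hy
    have hy0 : (0:ℝ) ≤ y := hy
    have hp : 0 < 1 + y / c := by positivity
    have h1 : HasDerivAt (fun y : ℝ => Real.exp (-y)) (Real.exp (-y) * (-1)) y :=
      (hasDerivAt_neg y).exp
    have h2 : HasDerivAt (fun y : ℝ => Real.log (1 + y / c)) ((1 / c) / (1 + y / c)) y :=
      (((hasDerivAt_id y).div_const c).const_add 1).log hp.ne'
    have h3 := (h1.mul h2).neg
    refine h3.congr_deriv ?_
    have : c + y ≠ 0 := by positivity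
    have e : (1 / c) / (1 + y / c) = (c + y)⁻¹ := by field_simp
    rw [e]; ring
  have ht : Filter.Tendsto (fun y => -(Real.exp (-y) * Real.log (1 + y / c))) Filter.atTop (nhds 0) := by
    rw [← neg_zero]
    refine Filter.Tendsto.neg ?_
    have h0 := (Real.tendsto_pow_mul_exp_neg_atTop_nhds_zero 1).const_mul c⁻¹
    rw [mul_zero] at h0
    refine squeeze_zero' ?_ ?_ h0
    · filter_upwards [Filter.eventually_gt_atTop 0] with y hy
      have hyc : 0 < y / c := by positivity
      have hl : 0 ≤ Real.log (1 + y / c) := Real.log_nonneg (by linarith)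
      positivity
    · filter_upwards [Filter.eventually_gt_atTop 0] with y hy
      have hyc : 0 < y / c := by positivity
      have hl2 : Real.log (1 + y / c) ≤ y / c := by
        have := Real.log_le_sub_one_of_pos (by linarith : 0 < 1 + y / c)
        linarith
      calc _ ≤ Real.exp (-y) * (y / c) := by gcongr
        _ = _ := by field_simp
  have hI := integral_Ioi_of_hasDerivAt_of_tendsto' hd ((aux_int1 c hc).sub (aux_int2 c hc)) ht
  rw [integral_sub (aux_int1 c hc) (aux_int2 c hc)] at hI
  simp only [zero_div, add_zero, Real.log_one, mul_zero, neg_zero, sub_zero] at hI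
  rw [sub_eq_zero.mp hI]
  have hs := (measurePreserving_add_right volume c).setIntegral_preimage_emb
    (measurableEmbedding_addRight c) (fun t : ℝ => t⁻¹ * Real.exp (-t)) (Ioi c)
  rw [← hs, ← integral_const_mul]
  have : (fun x => x + c) ⁻¹' Ioi c = Ioi (0:ℝ) := by ext; simp
  rw [this]
  refine integral_congr_ae (Filter.Eventually.of_forall fun y => ?_)
  simp only
  rw [neg_add, Real.exp_add, Real.exp_neg c, add_comm c y]
  have := Real.exp_pos c
  field_simp

lemma aux_dens (ρ φ : ℝ → ℝ) (hρ : Measurable ρ) (h1 : ∀ x, 0 < x → ρ x = φ x)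
    (h2 : ∀ x, x < 0 → ρ x = 0) (F : ℝ → ENNReal) (hF : Measurable F) :
    ∫⁻ x, F x ∂(volume.withDensity fun x => ENNReal.ofReal (ρ x)) =
      ∫⁻ x in Ioi (0:ℝ), ENNReal.ofReal (φ x) * F x := by
  rw [lintegral_withDensity_eq_lintegral_mul _ (by fun_prop) hF,
    ← lintegral_indicator measurableSet_Ioi]
  refine lintegral_congr_ae ?_
  have : ∀ᵐ x : ℝ, x ≠ 0 := Measure.ae_ne volume 0
  filter_upwards [this] with x hx
  rcases lt_or_gt_of_ne hx with h | h
  · simp [h2 x h, h.le]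
  · simp [h1 x h, h]

lemma aux_inner (b η x : ℝ) (hb : 0 < b) (hx : 0 < x) :
    ∫⁻ y in Ioi (0:ℝ), ENNReal.ofReal (Real.exp (-y)) *
        ENNReal.ofReal (Real.logb 2 (1 + (1 / b) * y * x ^ (-η))) =
      ENNReal.ofReal ((Real.log 2)⁻¹ * (Real.exp (b * x ^ η) *
        ∫ t in Ioi (b * x ^ η), t⁻¹ * Real.exp (-t))) := by
  have hc : 0 < b * x ^ η := by positivity
  have hl2 : 0 < Real.log 2 := Real.log_pos (by norm_num)
  rw [← aux_key _ hc, ← integral_const_mul, ofReal_integral_eq_lintegral_ofReal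
    ((aux_int1 _ hc).const_mul _)]
  · refine lintegral_congr fun y => ?_
    rw [← ENNReal.ofReal_mul (Real.exp_pos _).le]
    congr 1
    have : (1 / b) * y * x ^ (-η) = y / (b * x ^ η) := by
      rw [Real.rpow_neg hx.le]; field_simp
    rw [this, Real.logb]; field_simp
  · filter_upwards [ae_restrict_mem measurableSet_Ioi] with y hy
    have hy0 : (0:ℝ) < y := hy
    have hyc : 0 < y / (b * x ^ η) := by positivity
    have hl : 0 ≤ Real.log (1 + y / (b * x ^ η)) := Real.log_nonneg (by linarith)
    simp only [Pi.zero_apply]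
    positivity

lemma aux_meas (b η : ℝ) :
    StronglyMeasurable (fun x : ℝ => ∫ t in Ioi (b * x ^ η), t⁻¹ * Real.exp (-t)) := by
  have hS : MeasurableSet {p : ℝ × ℝ | b * p.1 ^ η < p.2} :=
    measurableSet_lt (by fun_prop) (by fun_prop)
  have hm : Measurable ({p : ℝ × ℝ | b * p.1 ^ η < p.2}.indicator
      (fun p : ℝ × ℝ => p.2⁻¹ * Real.exp (-p.2))) :=
    Measurable.indicator (by fun_prop) hS
  have := hm.stronglyMeasurable.integral_prod_right' (ν := (volume : Measure ℝ))
  convert this using 2 with x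
  rw [← integral_indicator measurableSet_Ioi]
  rfl

/-- Theorem 1, first part (equation (13)): if the serving distance `X` has density
`2πλ x e^{-πλ x²}` on `(0,∞)`, the fading gain `h ~ Exp(1)` is independent of `X`,
and `b, η > 0`, then the ergodic capacity satisfies
`E[log₂(1 + (1/b) h X^{-η})]
  = (2πλ/ln 2) ∫₀^∞ e^{b x^η} Γ(0, b x^η) x e^{-πλ x²} dx`,
where `Γ(0,z) = ∫_z^∞ t⁻¹ e^{-t} dt` is the upper incomplete gamma function. -/
theorem ergodic_capacity_nearest_rrh
    {Ω : Type*} [MeasurableSpace Ω] (μ : Measure Ω) [IsProbabilityMeasure μ]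
    (lam b η : ℝ) (hlam : 0 < lam) (hb : 0 < b) (hη : 0 < η)
    (X h : Ω → ℝ) (hXm : Measurable X) (hm : Measurable h)
    (hX : Measure.map X μ = volume.withDensity (fun x =>
      ENNReal.ofReal (if 0 < x then 2 * π * lam * x * Real.exp (-(π * lam * x ^ 2)) else 0)))
    (hexp : Measure.map h μ =
      volume.withDensity (fun x => ENNReal.ofReal (if 0 ≤ x then Real.exp (-x) else 0)))
    (hindep : IndepFun X h μ) :
    ∫ ω, Real.logb 2 (1 + (1 / b) * h ω * X ω ^ (-η)) ∂μ =
      (2 * π * lam / Real.log 2) *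
        ∫ x in Ioi (0 : ℝ),
          Real.exp (b * x ^ η) * (∫ t in Ioi (b * x ^ η), t⁻¹ * Real.exp (-t)) *
            (x * Real.exp (-(π * lam * x ^ 2))) := by
  have hl2 : 0 < Real.log 2 := Real.log_pos (by norm_num)
  have hρX : Measurable (fun x : ℝ =>
      if 0 < x then 2 * π * lam * x * Real.exp (-(π * lam * x ^ 2)) else 0) :=
    Measurable.ite (measurableSet_lt measurable_const measurable_id) (by fun_prop) (by fun_prop)
  have hρh : Measurable (fun x : ℝ => if 0 ≤ x then Real.exp (-x) else 0) :=
    Measurable.ite (measurableSet_le measurable_const measurable_id) (by fun_prop) (by fun_prop)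
  have hXpos : ∀ᵐ ω ∂μ, 0 < X ω := by
    refine ae_of_ae_map hXm.aemeasurable ?_
    rw [hX, ae_withDensity_iff (by fun_prop)]
    refine Filter.Eventually.of_forall fun x hx => ?_
    by_contra hn
    simp [hn] at hx
  have hhpos : ∀ᵐ ω ∂μ, 0 ≤ h ω := by
    refine ae_of_ae_map hm.aemeasurable ?_
    rw [hexp, ae_withDensity_iff (by fun_prop)]
    refine Filter.Eventually.of_forall fun x hx => ?_
    by_contra hn
    simp [hn] at hx
  have hg : Measurable (fun p : ℝ × ℝ =>
      ENNReal.ofReal (Real.logb 2 (1 + (1 / b) * p.2 * p.1 ^ (-η)))) := by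
    unfold Real.logb
    fun_prop
  have : IsProbabilityMeasure (μ.map X) := Measure.isProbabilityMeasure_map hXm.aemeasurable
  have : IsProbabilityMeasure (μ.map h) := Measure.isProbabilityMeasure_map hm.aemeasurable
  have hpos : ∀ x : ℝ, 0 < x → 0 ≤ ∫ t in Ioi (b * x ^ η), t⁻¹ * Real.exp (-t) := by
    intro x hx
    refine setIntegral_nonneg measurableSet_Ioi fun t ht => ?_
    have : 0 < b * x ^ η := by positivity
    have : 0 < t := this.trans ht
    positivity
  have hin : Measurable (fun x : ℝ => ∫⁻ y, ENNReal.ofReal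
      (Real.logb 2 (1 + (1 / b) * y * x ^ (-η))) ∂(μ.map h)) :=
    hg.lintegral_prod_right'
  rw [integral_eq_lintegral_of_nonneg_ae, ← integral_const_mul, integral_eq_lintegral_of_nonneg_ae]
  · congr 1
    rw [← lintegral_map (f := fun p : ℝ × ℝ =>
        ENNReal.ofReal (Real.logb 2 (1 + (1 / b) * p.2 * p.1 ^ (-η)))) hg (hXm.prodMk hm),
      hindep.map_prod_eq_prod_map_map hXm.aemeasurable hm.aemeasurable,
      lintegral_prod _ hg.aemeasurable]
    simp only
    rw [hX, aux_dens _ (fun x => 2 * π * lam * x * Real.exp (-(π * lam * x ^ 2))) hρX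
      (fun x hx => by simp [hx]) (fun x hx => by simp [hx.le]) _ hin]
    refine setLIntegral_congr_fun measurableSet_Ioi fun x hx => ?_
    have hx0 : (0:ℝ) < x := hx
    rw [hexp, aux_dens _ (fun y => Real.exp (-y)) hρh
      (fun x hx => by simp [hx.le]) (fun x hx => by simp [hx])
      (fun y => ENNReal.ofReal (Real.logb 2 (1 + (1 / b) * y * x ^ (-η))))
      (hg.comp measurable_prodMk_left), aux_inner b η x hb hx0,
      ← ENNReal.ofReal_mul (by positivity)]
    congr 1
    field_simp
  · filter_upwards [ae_restrict_mem measurableSet_Ioi] with x hx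
    have hx0 : (0:ℝ) < x := hx
    have := hpos x hx0
    simp only [Pi.zero_apply]
    positivity
  · have := (aux_meas b η).measurable
    refine Measurable.aestronglyMeasurable ?_
    fun_prop
  · filter_upwards [hXpos, hhpos] with ω h1 h2
    refine Real.logb_nonneg (by norm_num) ?_
    have : 0 ≤ (1 / b) * h ω * X ω ^ (-η) := by positivity
    linarith
  · refine Measurable.aestronglyMeasurable ?_
    unfold Real.logb
    fun_prop
end

section
/- For every real a > 0, every real η > 2, and every positive integer S, ∫₀^∞ (1 − (1 + a r^{-η})^{-S}) · r dr = (a^{2/η} / (η · Γ(S))) · Σ_{μ=1}^{S} C(S,μ) · Γ(μ − 2/η) · Γ(S − μ + 2/η), where C(S,μ) is the binomial coefficient and Γ is the Gamma function. (All Gamma arguments are positive since η > 2 implies 2/η < 1 ≤ μ.) -/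
open MeasureTheory Real Set Finset

theorem real_beta_Ioo (p q : ℝ) (hp : 0 < p) (hq : 0 < q) :
    ∫ x in Ioo (0 : ℝ) 1, x ^ (p - 1) * (1 - x) ^ (q - 1)
      = Real.Gamma p * Real.Gamma q / Real.Gamma (p + q) := by
  have h := Complex.betaIntegral_eq_Gamma_mul_div (u := (p : ℂ)) (v := (q : ℂ))
    (by simpa using hp) (by simpa using hq)
  rw [← Complex.ofReal_add, Complex.Gamma_ofReal, Complex.Gamma_ofReal, Complex.Gamma_ofReal,
    Complex.betaIntegral, intervalIntegral.integral_of_le zero_le_one,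
    integral_Ioc_eq_integral_Ioo] at h
  have e : ∫ x in Ioo (0 : ℝ) 1, (x : ℂ) ^ ((p : ℂ) - 1) * (1 - (x : ℂ)) ^ ((q : ℂ) - 1)
      = ∫ x in Ioo (0 : ℝ) 1, ((x ^ (p - 1) * (1 - x) ^ (q - 1) : ℝ) : ℂ) := by
    refine setIntegral_congr_fun measurableSet_Ioo fun x hx => ?_
    rw [Complex.ofReal_mul, Complex.ofReal_cpow hx.1.le,
      Complex.ofReal_cpow (by linarith [hx.2] : (0 : ℝ) ≤ 1 - x)]
    push_cast
    rfl
  rw [e, integral_complex_ofReal] at h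
  exact_mod_cast h

theorem real_beta_Ioi (p q : ℝ) (hp : 0 < p) (hq : 0 < q) :
    ∫ t in Ioi (0 : ℝ), t ^ (p - 1) / (1 + t) ^ (p + q)
      = Real.Gamma p * Real.Gamma q / Real.Gamma (p + q) := by
  rw [← real_beta_Ioo p q hp hq]
  have im : (fun t : ℝ => t / (1 + t)) '' (Ioi 0) = Set.Ioo (0:ℝ) 1 := by
    ext x
    constructor
    · rintro ⟨t, ht, rfl⟩
      have ht : 0 < t := ht
      refine ⟨by positivity, ?_⟩
      simp only
      rw [div_lt_one (by positivity)]
      linarith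
    · rintro ⟨h0, h1⟩
      have : 0 < 1 - x := by linarith
      refine ⟨x / (1 - x), div_pos h0 this, ?_⟩
      simp only
      field_simp
      ring
  rw [← im, integral_image_eq_integral_abs_deriv_smul (f' := fun t => 1 / (1 + t) ^ 2)
    measurableSet_Ioi]
  · refine setIntegral_congr_fun measurableSet_Ioi fun t ht => ?_
    have ht : 0 < t := ht
    have h1 : 0 < 1 + t := by positivity
    have e : 1 - t / (1 + t) = (1 + t)⁻¹ := by field_simp; ring
    simp only [smul_eq_mul]
    rw [e, abs_of_pos (by positivity), Real.div_rpow ht.le h1.le, Real.inv_rpow h1.le,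
      show p + q = (p - 1) + (q - 1) + (2 : ℕ) by push_cast; ring, Real.rpow_add h1,
      Real.rpow_add h1, Real.rpow_natCast]
    have := Real.rpow_pos_of_pos h1 (p - 1)
    have := Real.rpow_pos_of_pos h1 (q - 1)
    field_simp
  · intro t ht
    have ht : 0 < t := ht
    have h1 : 1 + t ≠ 0 := by positivity
    have := ((hasDerivAt_id t).div ((hasDerivAt_id t).const_add 1) h1)
    refine HasDerivAt.hasDerivWithinAt ?_
    have e : (1 : ℝ) / (1 + t) ^ 2 = (1 * (1 + id t) - id t * 1) / (1 + id t) ^ 2 := by simp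
    simp only [e]
    exact this
  · intro s hs t ht h
    have hs : 0 < s := hs
    have ht : 0 < t := ht
    simp only at h
    rw [div_eq_div_iff (by positivity) (by positivity)] at h
    linarith

theorem integral_h (c : ℝ) (S : ℕ) (hc : 0 < c) (hc1 : c < 1) :
    ∫ t in Ioi (0 : ℝ), (1 - 1 / (1 + t) ^ S) * t ^ (-c - 1) =
      ∑ μ ∈ Finset.Icc 1 S, (S.choose μ : ℝ) *
        (Real.Gamma (μ - c) * Real.Gamma (S - μ + c) / Real.Gamma S) := by
  have key : ∀ μ ∈ Finset.Icc 1 S, 0 < Real.Gamma (μ - c) * Real.Gamma (S - μ + c) / Real.Gamma S ∧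
      ∫ t in Ioi (0 : ℝ), t ^ ((μ : ℝ) - c - 1) / (1 + t) ^ S =
      Real.Gamma (μ - c) * Real.Gamma (S - μ + c) / Real.Gamma S := by
    intro μ hμ
    rw [Finset.mem_Icc] at hμ
    have h1 : (1 : ℝ) ≤ μ := by exact_mod_cast hμ.1
    have h2 : (μ : ℝ) ≤ S := by exact_mod_cast hμ.2
    have hp : 0 < (μ : ℝ) - c := by linarith
    have hq : 0 < (S : ℝ) - μ + c := by linarith
    have := Real.Gamma_pos_of_pos hp
    have := Real.Gamma_pos_of_pos hq
    have := Real.Gamma_pos_of_pos (show (0 : ℝ) < S by linarith)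
    refine ⟨by positivity, ?_⟩
    have := real_beta_Ioi _ _ hp hq
    rw [show (μ : ℝ) - c + (S - μ + c) = S by ring] at this
    simpa only [Real.rpow_natCast] using this
  have e : ∫ t in Ioi (0 : ℝ), (1 - 1 / (1 + t) ^ S) * t ^ (-c - 1) =
      ∫ t in Ioi (0 : ℝ), ∑ μ ∈ Finset.Icc 1 S,
        (S.choose μ : ℝ) * (t ^ ((μ : ℝ) - c - 1) / (1 + t) ^ S) := by
    refine setIntegral_congr_fun measurableSet_Ioi fun t ht => ?_
    have ht : 0 < t := ht
    have hb : (1 + t) ^ S = 1 + ∑ μ ∈ Finset.Icc 1 S, (S.choose μ : ℝ) * t ^ μ := by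
      rw [add_comm 1 t, add_pow, Finset.range_eq_Ico, Finset.sum_eq_sum_Ico_succ_bot (by omega)]
      simp only [one_pow, pow_zero, Nat.choose_zero_right, Nat.cast_one, mul_one]
      congr 1
      refine Finset.sum_congr (by ext; simp) fun _ _ => mul_comm _ _
    have hpos : 0 < (1 + t) ^ S := by positivity
    have : (1 - 1 / (1 + t) ^ S) = (∑ μ ∈ Finset.Icc 1 S, (S.choose μ : ℝ) * t ^ μ) / (1 + t) ^ S := by
      rw [eq_div_iff hpos.ne', sub_mul, one_div, inv_mul_cancel₀ hpos.ne']
      linarith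
    rw [this, Finset.sum_div, Finset.sum_mul]
    refine Finset.sum_congr rfl fun μ _ => ?_
    rw [show (μ : ℝ) - c - 1 = μ + (-c - 1) by ring, Real.rpow_add ht, Real.rpow_natCast]
    ring
  rw [e, integral_finsetSum]
  · refine Finset.sum_congr rfl fun μ hμ => ?_
    rw [integral_const_mul, (key μ hμ).2]
  · intro μ hμ
    refine Integrable.const_mul (.of_integral_ne_zero ?_) _
    rw [(key μ hμ).2]
    exact (key μ hμ).1.ne'

/-- For every real `a > 0`, real `η > 2` and positive integer `S`,
`∫₀^∞ (1 − (1 + a r^{-η})^{-S}) r dr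
  = (a^{2/η}/(η Γ(S))) Σ_{μ=1}^{S} C(S,μ) Γ(μ − 2/η) Γ(S − μ + 2/η)`. -/
theorem integral_one_sub_inv_pow_one_add_rpow (a η : ℝ) (S : ℕ)
    (ha : 0 < a) (hη : 2 < η) (hS : 0 < S) :
    ∫ r in Ioi (0 : ℝ), (1 - 1 / (1 + a * r ^ (-η)) ^ S) * r =
      a ^ (2 / η) / (η * Real.Gamma (S : ℝ)) *
        ∑ μ ∈ Finset.Icc 1 S, (S.choose μ : ℝ) *
          Real.Gamma ((μ : ℝ) - 2 / η) * Real.Gamma ((S : ℝ) - (μ : ℝ) + 2 / η) := by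
  have hη0 : 0 < η := by linarith
  have H := integral_h (2 / η) S (by positivity) (by rw [div_lt_one hη0]; exact hη)
  have H2 := integral_comp_mul_left_Ioi
    (fun t : ℝ => (1 - 1 / (1 + t) ^ S) * t ^ (-(2 / η) - 1)) 0 ha
  rw [mul_zero, H, ← integral_comp_rpow_Ioi _ (neg_ne_zero.mpr hη0.ne')] at H2
  have e : ∫ r in Ioi (0 : ℝ), (|-η| * r ^ (-η - 1)) •
        ((1 - 1 / (1 + a * r ^ (-η)) ^ S) * (a * r ^ (-η)) ^ (-(2 / η) - 1)) =
      ∫ r in Ioi (0 : ℝ), (η * a ^ (-(2 / η) - 1)) * ((1 - 1 / (1 + a * r ^ (-η)) ^ S) * r) := by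
    refine setIntegral_congr_fun measurableSet_Ioi fun r hr => ?_
    have hr : 0 < r := hr
    simp only [smul_eq_mul]
    rw [abs_neg, abs_of_pos hη0, Real.mul_rpow ha.le (by positivity), ← Real.rpow_mul hr.le]
    have : r ^ (-η - 1) * r ^ (-η * (-(2 / η) - 1)) = r := by
      rw [← Real.rpow_add hr]
      conv_rhs => rw [← Real.rpow_one r]
      congr 1
      field_simp
      ring
    calc _ = (η * a ^ (-(2 / η) - 1)) * ((1 - 1 / (1 + a * r ^ (-η)) ^ S) *
          (r ^ (-η - 1) * r ^ (-η * (-(2 / η) - 1)))) := by ring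
      _ = _ := by rw [this]
  rw [e, integral_const_mul, smul_eq_mul] at H2
  have hA : a ^ (-(2 / η) - 1) = a⁻¹ * (a ^ (2 / η))⁻¹ := by
    rw [Real.rpow_sub ha, Real.rpow_neg ha.le, Real.rpow_one]
    field_simp
  have hap : 0 < a ^ (2 / η) := Real.rpow_pos_of_pos ha _
  have hG : 0 < Real.Gamma S := Real.Gamma_pos_of_pos (by exact_mod_cast hS)
  have hs : ∑ μ ∈ Finset.Icc 1 S, (S.choose μ : ℝ) *
        (Real.Gamma (μ - 2 / η) * Real.Gamma (S - μ + 2 / η) / Real.Gamma S) =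
      (∑ μ ∈ Finset.Icc 1 S, (S.choose μ : ℝ) *
          Real.Gamma ((μ : ℝ) - 2 / η) * Real.Gamma ((S : ℝ) - (μ : ℝ) + 2 / η)) / Real.Gamma S := by
    rw [Finset.sum_div]
    exact Finset.sum_congr rfl fun μ _ => by ring
  rw [hs, hA] at H2
  generalize (∑ μ ∈ Finset.Icc 1 S, (S.choose μ : ℝ) *
          Real.Gamma ((μ : ℝ) - 2 / η) * Real.Gamma ((S : ℝ) - (μ : ℝ) + 2 / η)) = X at *
  generalize (∫ r in Ioi (0 : ℝ), (1 - 1 / (1 + a * r ^ (-η)) ^ S) * r) = I at *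
  generalize a ^ (2 / η) = A at *
  field_simp at H2 ⊢
  linarith
end
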